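/- Fix θ ∈ F with θ² = q and t ∈ ℤ. Let V be a finite-dimensional U_q(sl2)-module of type 1, meaning V ≠ 0 and the action of k on V is diagonalizable with every eigenvalue of the form q^λ for some λ ∈ ℤ; write V(λ) = {v ∈ V : k v = q^λ v}. Define x, y, z ∈ End(V) as the actions of k⁻¹ − k^{−1−t} e q^{1+t}(q − q⁻¹)θ⁻¹, k, and k⁻¹ + f k^{t} q^{−t}(q − q⁻¹)θ respectively, and set n_x = q(1 − y z)/(q − q⁻¹), n_z = q(1 − x y)/(q − q⁻¹) (both nilpotent on V). Let Υ ∈ End(V) act on each weight space V(λ) as the scalar (−θ)^{−λ²}, and let T⁻¹ ∈ End(V) act on each V(λ) as Σ_{a,b,c ∈ ℕ, a−b+c=λ} (f^a e^b f^c / ([a]!_q [b]!_q [c]!_q)) (−1)^b q^{ac−b} (a finite sum since e, f are nilpotent on V). Then T⁻¹ = exp_q(n_z) ∘ exp_q(n_x) ∘ Υ ∘ exp_q(n_z). -/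

import Mathlib

namespace Lusztig

variable (F : Type*) [Field F] (q : F)



/-- The q-integer [n]_q = (qⁿ − q⁻ⁿ)/(q − q⁻¹). -/
noncomputable def qInt (n : ℤ) : F := (q ^ n - q ^ (-n)) / (q - q⁻¹)

/-- The q-factorial [n]!_q = [n]_q [n−1]_q ⋯ [1]_q, with [0]!_q = 1. -/
noncomputable def qFact (n : ℕ) : F := ∏ i ∈ Finset.range n, qInt F q ((i : ℤ) + 1)

/-- The q-exponential exp_q(φ) = Σ_{i≥0} q^{binom(i,2)} φ^i / [i]!_q of a nilpotent
endomorphism φ of a finite-dimensional space.  Since the nilpotency index of φ is at most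
`finrank F V`, the series may be truncated at `finrank F V + 1` terms. -/
noncomputable def expq {V : Type*} [AddCommGroup V] [Module F V] (φ : Module.End F V) :
    Module.End F V :=
  ∑ i ∈ Finset.range (Module.finrank F V + 1), (q ^ (i.choose 2) / qFact F q i) • φ ^ i

/-- The inverse of the q-exponential: exp_{q⁻¹}(−φ) = Σ_{i≥0} (−1)^i q^{−binom(i,2)} φ^i / [i]!_q. -/
noncomputable def expqInv {V : Type*} [AddCommGroup V] [Module F V] (φ : Module.End F V) :
    Module.End F V :=
  ∑ i ∈ Finset.range (Module.finrank F V + 1),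
    (((-1 : F) ^ i * (q ^ (i.choose 2))⁻¹) / qFact F q i) • φ ^ i

/-- The q-exponential for square matrices (truncated at n + 1 terms, which is enough
for nilpotent matrices). -/
noncomputable def expqM {n : ℕ} (φ : Matrix (Fin n) (Fin n) F) : Matrix (Fin n) (Fin n) F :=
  ∑ i ∈ Finset.range (n + 1), (q ^ (i.choose 2) / qFact F q i) • φ ^ i


section helpers

theorem s_ne {F : Type*} [Field F] {q : F} (hq : q ≠ 0) (hroot : ∀ n : ℕ, 0 < n → q ^ n ≠ 1) :
    q - q⁻¹ ≠ 0 := by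
  intro h
  apply hroot 2 (by norm_num)
  have : q = q⁻¹ := sub_eq_zero.mp h
  rw [pow_two]
  nth_rewrite 2 [this]
  exact mul_inv_cancel₀ hq

theorem qpow_inj {F : Type*} [Field F] {q : F} (hq : q ≠ 0)
    (hroot : ∀ n : ℕ, 0 < n → q ^ n ≠ 1) : Function.Injective (fun l : ℤ => q ^ l) := by
  have key : ∀ a b : ℤ, a < b → q ^ a ≠ q ^ b := by
    intro a b hab h
    apply hroot (b - a).toNat (by omega)
    rw [← zpow_natCast, Int.toNat_of_nonneg (by omega), zpow_sub₀ hq, ← h,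
      div_self (zpow_ne_zero _ hq)]
  intro a b h
  rcases lt_trichotomy a b with h1 | h1 | h1
  · exact absurd h (key _ _ h1)
  · exact h1
  · exact absurd h.symm (key _ _ h1)

theorem qInt_ne {F : Type*} [Field F] {q : F} (hq : q ≠ 0)
    (hroot : ∀ n : ℕ, 0 < n → q ^ n ≠ 1) (i : ℕ) : qInt F q ((i : ℤ) + 1) ≠ 0 := by
  unfold qInt
  apply div_ne_zero _ (s_ne hq hroot)
  intro h
  have := qpow_inj hq hroot (sub_eq_zero.mp h)
  omega

theorem qFact_ne {F : Type*} [Field F] {q : F} (hq : q ≠ 0)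
    (hroot : ∀ n : ℕ, 0 < n → q ^ n ≠ 1) (i : ℕ) : qFact F q i ≠ 0 := by
  unfold qFact
  exact Finset.prod_ne_zero_iff.mpr fun j _ => qInt_ne hq hroot j

/-- coefficients of the exponential -/
theorem coef_rec {F : Type*} [Field F] {q : F} (hq : q ≠ 0)
    (hroot : ∀ n : ℕ, 0 < n → q ^ n ≠ 1) (i : ℕ) :
    (q ^ ((i + 1).choose 2) / qFact F q (i + 1)) * ((q ^ i)⁻¹ * qInt F q ((i : ℤ) + 1))
      = q ^ (i.choose 2) / qFact F q i := by
  have h1 := qInt_ne hq hroot i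
  have h2 := qFact_ne hq hroot i
  have h3 : qFact F q (i + 1) = qFact F q i * qInt F q ((i : ℤ) + 1) := by
    unfold qFact; rw [Finset.prod_range_succ]
  have h4 : (i + 1).choose 2 = i + i.choose 2 := by
    rw [Nat.choose_succ_succ' i 1]; simp
  rw [h3, h4, pow_add]
  field_simp

theorem c_val {F : Type*} [Field F] {q : F} (hq : q ≠ 0)
    (hroot : ∀ n : ℕ, 0 < n → q ^ n ≠ 1) (i : ℕ) :
    (q - q⁻¹) * ((q ^ i)⁻¹ * qInt F q ((i : ℤ) + 1)) = q * (1 - (q ^ (2 * (i + 1)))⁻¹) := by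
  have h1 := s_ne hq hroot
  have : qInt F q ((i : ℤ) + 1) * (q - q⁻¹) = q ^ (i + 1) - (q ^ (i + 1))⁻¹ := by
    unfold qInt
    rw [div_mul_cancel₀ _ h1, zpow_neg]
    norm_cast
  rw [mul_comm, mul_assoc, this, two_mul, pow_add]
  field_simp
  ring

theorem expq_lemmas {F : Type*} [Field F] {q : F} (hq : q ≠ 0)
    (hroot : ∀ n : ℕ, 0 < n → q ^ n ≠ 1)
    {V : Type*} [AddCommGroup V] [Module F V]
    (X Y Z n : Module.End F V)
    (hXY : q • (X * Y) - q⁻¹ • (Y * X) = (q - q⁻¹) • 1)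
    (hYZ : q • (Y * Z) - q⁻¹ • (Z * Y) = (q - q⁻¹) • 1)
    (hZX : q • (Z * X) - q⁻¹ • (X * Z) = (q - q⁻¹) • 1)
    (hn : n = (q / (q - q⁻¹)) • (1 - X * Y))
    (hnil : n ^ (Module.finrank F V) = 0) :
    Y * expq F q n * X = expq F q n ∧
    expq F q n * Y = Y * X * Y * expq F q n ∧
    expq F q n * Z - Z * expq F q n = Y * expq F q n - expq F q n * X := by
  have hs := s_ne hq hroot
  have hs2 : q ^ 2 - 1 ≠ 0 := sub_ne_zero.mpr (hroot 2 (by norm_num))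
  have hXYn : X * Y = 1 - ((q - q⁻¹) / q) • n := by
    rw [hn, smul_smul, show (q - q⁻¹) / q * (q / (q - q⁻¹)) = 1 by field_simp, one_smul]
    abel
  have hYXn : Y * X = 1 - (q * (q - q⁻¹)) • n := by
    have : Y * X = q • (q • (X * Y) - (q - q⁻¹) • 1) := by
      rw [← hXY, sub_sub_cancel, smul_smul, mul_inv_cancel₀ hq, one_smul]
    rw [this, hXYn]
    match_scalars <;> field_simp
    ring
  have hnY : n * Y = (q ^ 2)⁻¹ • (Y * n) := by
    have h1 : Y * (X * Y) = (Y * X) * Y := (mul_assoc _ _ _).symm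
    rw [hXYn, hYXn, mul_sub, sub_mul, mul_one, one_mul, sub_right_inj, mul_smul_comm,
      smul_mul_assoc] at h1
    have h2 := congrArg (fun w => (q * (q - q⁻¹))⁻¹ • w) h1
    simp only [smul_smul] at h2
    rw [inv_mul_cancel₀ (mul_ne_zero hq hs), one_smul] at h2
    rw [← h2]; congr 1; field_simp
  have hnX : n * X = q ^ 2 • (X * n) := by
    have h1 : X * (Y * X) = (X * Y) * X := (mul_assoc _ _ _).symm
    rw [hXYn, hYXn, mul_sub, sub_mul, mul_one, one_mul, sub_right_inj, mul_smul_comm,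
      smul_mul_assoc] at h1
    have h2 := congrArg (fun w => ((q - q⁻¹) / q)⁻¹ • w) h1
    simp only [smul_smul] at h2
    rw [inv_mul_cancel₀ (div_ne_zero hs hq), one_smul] at h2
    rw [← h2]; congr 1; field_simp
  have hnZ : n * Z = Z * n + Y - X := by
    have e1 : Y * Z = (q⁻¹ * q⁻¹) • (Z * Y) + (q⁻¹ * (q - q⁻¹)) • 1 := by
      rw [← smul_smul, ← smul_smul, ← smul_add, ← hYZ, add_sub_cancel, smul_smul,
        inv_mul_cancel₀ hq, one_smul]
    have e2 : X * Z = (q * q) • (Z * X) - (q * (q - q⁻¹)) • 1 := by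
      rw [← smul_smul, ← smul_smul, ← smul_sub, ← hZX, sub_sub_cancel, smul_smul,
        mul_inv_cancel₀ hq, one_smul]
    have e3 : X * Y * Z = Z * (X * Y) + (q⁻¹ * (q - q⁻¹)) • (X - Y) := by
      rw [mul_assoc, e1, mul_add, mul_smul_comm, ← mul_assoc, e2, sub_mul, smul_mul_assoc,
        mul_smul_comm, mul_one, smul_mul_assoc, one_mul, mul_assoc]
      match_scalars <;> field_simp
    rw [hn, smul_mul_assoc, sub_mul, one_mul, e3, mul_smul_comm, mul_sub Z, mul_one]
    match_scalars <;> field_simp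
  have hpY : ∀ i : ℕ, n ^ i * Y = (q ^ (2 * i))⁻¹ • (Y * n ^ i) := by
    intro i
    induction i with
    | zero => simp
    | succ i ih =>
      rw [pow_succ', mul_assoc, ih, mul_smul_comm, ← mul_assoc, hnY, smul_mul_assoc, smul_smul,
        mul_assoc]
      congr 1
      rw [mul_add, pow_add, mul_inv]
  have hpX : ∀ i : ℕ, n ^ i * X = (q ^ (2 * i)) • (X * n ^ i) := by
    intro i
    induction i with
    | zero => simp
    | succ i ih =>
      rw [pow_succ', mul_assoc, ih, mul_smul_comm, ← mul_assoc, hnX, smul_mul_assoc, smul_smul,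
        mul_assoc]
      congr 1
      rw [mul_add, pow_add]
  have hpX' : ∀ i : ℕ, X * n ^ i = (q ^ (2 * i))⁻¹ • (n ^ i * X) := by
    intro i
    rw [hpX, smul_smul, inv_mul_cancel₀ (pow_ne_zero _ hq), one_smul]
  have hcv := c_val hq hroot
  have hpZ : ∀ i : ℕ, n ^ (i + 1) * Z - Z * n ^ (i + 1) =
      ((q ^ i)⁻¹ * qInt F q ((i : ℤ) + 1)) • (Y * n ^ i - n ^ i * X) := by
    intro i
    induction i with
    | zero =>
      have : (q ^ 0)⁻¹ * qInt F q (((0 : ℕ) : ℤ) + 1) = 1 := by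
        unfold qInt; simp [div_self hs]
      rw [this]
      simp only [zero_add, pow_one, hnZ, pow_zero, mul_one, one_mul, one_smul]
      abel
    | succ i ih =>
      have hci := hcv i
      have hci1 := hcv (i + 1)
      set c := (q ^ i)⁻¹ * qInt F q ((i : ℤ) + 1) with hc
      set c1 := (q ^ (i + 1))⁻¹ * qInt F q (((i + 1 : ℕ) : ℤ) + 1) with hc1
      have r1 : c1 = 1 + (q ^ 2)⁻¹ * c := by
        apply mul_left_cancel₀ hs
        rw [hci1, mul_add (q - q⁻¹), mul_left_comm (q - q⁻¹) _ c, hci, show 2 * (i + 1 + 1) = 2 * (i + 1) + 2 by ring,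
          pow_add]
        field_simp
        ring
      have r2 : c1 = c + (q ^ (2 * (i + 1)))⁻¹ := by
        apply mul_left_cancel₀ hs
        rw [hci1, mul_add (q - q⁻¹), hci, show 2 * (i + 1 + 1) = 2 * (i + 1) + 2 by ring, pow_add]
        field_simp
        ring
      have ih' : n ^ (i + 1) * Z = Z * n ^ (i + 1) + c • (Y * n ^ i - n ^ i * X) := by
        rw [← ih]; abel
      rw [pow_succ' n (i + 1), mul_assoc, ih', mul_add, ← mul_assoc n Z, hnZ, mul_smul_comm,
        mul_sub, ← mul_assoc n Y, hnY, ← mul_assoc n (n ^ i) X, ← pow_succ', sub_mul, add_mul,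
        hpX', smul_mul_assoc, mul_assoc Y, ← pow_succ', mul_assoc Z]
      rw [smul_sub, smul_sub, smul_smul]
      nth_rewrite 1 [r1]
      rw [r2]
      module
  set N := Module.finrank F V with hN
  set e : ℕ → F := fun i => q ^ (i.choose 2) / qFact F q i with he
  have her : ∀ i, e (i + 1) * ((q ^ i)⁻¹ * qInt F q ((i : ℤ) + 1)) = e i := coef_rec hq hroot
  have hB : expq F q n = ∑ i ∈ Finset.range (N + 1), e i • n ^ i := rfl
  have hB2 : expq F q n = ∑ i ∈ Finset.range N, e i • n ^ i := by
    rw [hB, Finset.sum_range_succ, hnil, smul_zero, add_zero]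
  refine ⟨?_, ?_, ?_⟩
  · have h1 : Y * expq F q n * X = Y * X * ∑ i ∈ Finset.range (N + 1), (e i * q ^ (2 * i)) • n ^ i := by
      rw [hB, mul_assoc, mul_assoc, Finset.sum_mul, Finset.mul_sum, Finset.mul_sum, Finset.mul_sum]
      refine Finset.sum_congr rfl fun i _ => ?_
      rw [smul_mul_assoc, hpX, smul_smul, mul_smul_comm, mul_smul_comm, mul_smul_comm]
    rw [h1, hYXn, sub_mul, one_mul]
    rw [Finset.sum_range_succ', hB, Finset.sum_range_succ' (fun i => e i • n ^ i)]
    have h2 : (q * (q - q⁻¹)) • n * (∑ k ∈ Finset.range N, (e (k + 1) * q ^ (2 * (k + 1))) • n ^ (k + 1) +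
        (e 0 * q ^ (2 * 0)) • n ^ 0) =
        ∑ k ∈ Finset.range N, (q * (q - q⁻¹) * (e k * q ^ (2 * k))) • n ^ (k + 1) := by
      rw [← Finset.sum_range_succ' (fun k => (e k * q ^ (2 * k)) • n ^ k), Finset.sum_range_succ,
        hnil, smul_zero, add_zero, Finset.mul_sum]
      refine Finset.sum_congr rfl fun i _ => ?_
      rw [smul_mul_smul_comm, ← pow_succ']
    rw [h2]
    have h3 : ∀ k, (e (k + 1) * q ^ (2 * (k + 1))) • n ^ (k + 1) -
        (q * (q - q⁻¹) * (e k * q ^ (2 * k))) • n ^ (k + 1) = e (k + 1) • n ^ (k + 1) := by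
      intro k
      rw [← sub_smul, ← her k]
      congr 1
      have := hcv k
      have h5 : q * (q - q⁻¹) * (e (k + 1) * ((q ^ k)⁻¹ * qInt F q ((k : ℤ) + 1)) * q ^ (2 * k)) =
        q * e (k + 1) * q ^ (2 * k) * ((q - q⁻¹) * ((q ^ k)⁻¹ * qInt F q ((k : ℤ) + 1))) := by ring
      rw [h5, this, mul_add, pow_add]
      field_simp
      ring
    rw [← Finset.sum_congr rfl (fun k _ => h3 k), Finset.sum_sub_distrib]
    simp only [mul_zero, pow_zero, mul_one]
    abel
  · have h1 : expq F q n * Y = Y * ∑ i ∈ Finset.range (N + 1), (e i * (q ^ (2 * i))⁻¹) • n ^ i := by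
      rw [hB, Finset.sum_mul, Finset.mul_sum]
      refine Finset.sum_congr rfl fun i _ => ?_
      rw [smul_mul_assoc, hpY, smul_smul, mul_smul_comm]
    rw [h1, mul_assoc Y X Y, mul_assoc Y, hXYn]
    congr 1
    rw [sub_mul, one_mul]
    nth_rewrite 2 [hB2]
    rw [hB, Finset.sum_range_succ', Finset.sum_range_succ' (fun i => e i • n ^ i), Finset.mul_sum]
    have h3 : ∀ k, (e (k + 1) * (q ^ (2 * (k + 1)))⁻¹) • n ^ (k + 1) =
        e (k + 1) • n ^ (k + 1) - ((q - q⁻¹) / q) • n * e k • n ^ k := by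
      intro k
      rw [smul_mul_smul_comm, ← pow_succ', ← sub_smul, ← her k]
      congr 1
      have := hcv k
      have h5 : ((q - q⁻¹) / q) * (e (k + 1) * ((q ^ k)⁻¹ * qInt F q ((k : ℤ) + 1))) =
        e (k + 1) / q * ((q - q⁻¹) * ((q ^ k)⁻¹ * qInt F q ((k : ℤ) + 1))) := by ring
      rw [h5, this]
      field_simp
      ring
    rw [Finset.sum_congr rfl (fun k _ => h3 k), Finset.sum_sub_distrib]
    simp only [mul_zero, pow_zero, mul_one, inv_one]
    abel
  · have hL : expq F q n * Z - Z * expq F q n =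
        ∑ i ∈ Finset.range N, e i • (Y * n ^ i - n ^ i * X) := by
      rw [hB, Finset.sum_mul, Finset.mul_sum, ← Finset.sum_sub_distrib, Finset.sum_range_succ']
      simp only [pow_zero, smul_mul_assoc, mul_smul_comm, one_mul, mul_one, sub_self, add_zero]
      refine Finset.sum_congr rfl fun i _ => ?_
      rw [← smul_sub, hpZ, smul_smul, her]
    rw [hL, hB2, Finset.sum_mul, Finset.mul_sum, ← Finset.sum_sub_distrib]
    refine Finset.sum_congr rfl fun i _ => ?_
    rw [smul_mul_assoc, mul_smul_comm, smul_sub]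

theorem expq_comm {F : Type*} [Field F] {q : F} {V : Type*} [AddCommGroup V] [Module F V]
    (r m n : Module.End F V) (h : r * m = n * r) : r * expq F q m = expq F q n * r := by
  unfold expq
  rw [Finset.mul_sum, Finset.sum_mul]
  refine Finset.sum_congr rfl fun i _ => ?_
  rw [mul_smul_comm, smul_mul_assoc]
  congr 1
  exact (SemiconjBy.pow_right (show SemiconjBy r m n from h) i)

theorem braid {F : Type*} [Field F] {q : F} (hq : q ≠ 0)
    (hroot : ∀ n : ℕ, 0 < n → q ^ n ≠ 1)
    {V : Type*} [AddCommGroup V] [Module F V]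
    (x y k z nx nz U : Module.End F V) (hyk : y * k = 1) (hky : k * y = 1)
    (hXY : q • (x * y) - q⁻¹ • (y * x) = (q - q⁻¹) • 1)
    (hYZ : q • (y * z) - q⁻¹ • (z * y) = (q - q⁻¹) • 1)
    (hZX : q • (z * x) - q⁻¹ • (x * z) = (q - q⁻¹) • 1)
    (hnx : nx = (q / (q - q⁻¹)) • (1 - y * z))
    (hnz : nz = (q / (q - q⁻¹)) • (1 - x * y))
    (hnilx : nx ^ (Module.finrank F V) = 0)
    (hnilz : nz ^ (Module.finrank F V) = 0)
    (hU1 : U * (y * x * y) = (x + y - k) * U)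
    (hU2 : U * (z + y - k) = y * z * y * U) :
    expq F q nz * (expq F q nx * U * expq F q nz) = expq F q nx * U * expq F q nz * expq F q nx ∧
    y * (expq F q nz * (expq F q nx * U * expq F q nz)) * y =
      expq F q nz * (expq F q nx * U * expq F q nz) := by
  obtain ⟨b1, b2, b3⟩ := expq_lemmas hq hroot x y z nz hXY hYZ hZX hnz hnilz
  obtain ⟨a1, -, a3⟩ := expq_lemmas hq hroot y z x nx hYZ hZX hXY hnx hnilx
  have ac : (y * z) * expq F q nx = expq F q nx * (y * z) := by
    apply expq_comm
    rw [hnx, mul_smul_comm, smul_mul_assoc, mul_sub, sub_mul, mul_one, one_mul]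
  set A := expq F q nx
  set B := expq F q nz
  have b4 : B * x = k * B := by
    conv_rhs => rw [← b1]
    rw [mul_assoc y, ← mul_assoc k, hky, one_mul]
  have a4 : A * k = z * A := by
    conv_lhs => rw [← a1]
    rw [mul_assoc, hyk, mul_one]
  have ax : A * (x + y - k) = x * A := by
    rw [mul_sub, mul_add, a4, ← sub_eq_zero]
    rw [← sub_eq_zero] at a3
    rw [← a3]; abel
  have bz : B * z = (z + y - k) * B := by
    rw [sub_mul, add_mul, ← b4, ← sub_eq_zero]
    rw [← sub_eq_zero] at b3
    rw [← b3]; abel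
  have ry : A * U * B * y = x * (A * U * B) := by
    rw [mul_assoc, b2, ← mul_assoc, mul_assoc A U, hU1, ← mul_assoc A, ax]
    simp only [mul_assoc]
  have rz : A * U * B * z = y * (A * U * B) := by
    have : A * (y * z * y) = y * A := by
      rw [← mul_assoc, ← ac, mul_assoc, mul_assoc, ← mul_assoc z, a1]
    rw [mul_assoc, bz, ← mul_assoc, mul_assoc A U, hU2, ← mul_assoc A, this]
    simp only [mul_assoc]
  have rn : A * U * B * nx = nz * (A * U * B) := by
    rw [hnx, hnz, mul_smul_comm, smul_mul_assoc, mul_sub, sub_mul, mul_one, one_mul,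
      ← mul_assoc _ y z, ry, mul_assoc x, rz, mul_assoc x y]
  have h1 : B * (A * U * B) = A * U * B * A := (expq_comm _ _ _ rn).symm
  refine ⟨h1, ?_⟩
  rw [h1, ← mul_assoc y, ← rz, mul_assoc, mul_assoc, ← mul_assoc z, a1]

theorem weight_component {F : Type*} [Field F] {q : F} (hq : q ≠ 0)
    (hroot : ∀ n : ℕ, 0 < n → q ^ n ≠ 1)
    {V : Type*} [AddCommGroup V] [Module F V] (K : Module.End F V)
    {ι : Type*} (S : Finset ι) (w : ι → V) (m : ι → ℤ)
    (hw : ∀ i ∈ S, w i ∈ K.eigenspace (q ^ m i)) (l : ℤ)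
    (h : ∑ i ∈ S, w i ∈ K.eigenspace (q ^ l)) :
    ∑ i ∈ S, w i = ∑ i ∈ S, if m i = l then w i else 0 := by
  have hind := (K.eigenspaces_iSupIndep) (q ^ l)
  rw [← Finset.sum_filter]
  have hsplit := Finset.sum_filter_add_sum_filter_not S (fun i => m i = l) w
  have h1 : ∑ i ∈ S with m i = l, w i ∈ K.eigenspace (q ^ l) := by
    refine Submodule.sum_mem _ fun i hi => ?_
    rw [Finset.mem_filter] at hi
    rw [← hi.2]; exact hw i hi.1
  have h2 : ∑ i ∈ S with ¬ m i = l, w i ∈ K.eigenspace (q ^ l) := by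
    rw [← hsplit] at h
    exact (Submodule.add_mem_iff_right _ h1).mp h
  have h3 : ∑ i ∈ S with ¬ m i = l, w i ∈ ⨆ (j) (_ : j ≠ q ^ l), K.eigenspace j := by
    refine Submodule.sum_mem _ fun i hi => ?_
    rw [Finset.mem_filter] at hi
    refine Submodule.mem_iSup_of_mem (q ^ m i) (Submodule.mem_iSup_of_mem ?_ (hw i hi.1))
    exact fun h => hi.2 (qpow_inj hq hroot h)
  have h4 := (Submodule.disjoint_def.mp hind) _ h2 h3
  rw [← hsplit, h4, add_zero]

theorem weight_ext {F : Type*} [Field F] {q : F}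
    {V : Type*} [AddCommGroup V] [Module F V] {K : Module.End F V}
    (ht : (⨆ l : ℤ, K.eigenspace (q ^ l)) = ⊤) {f g : Module.End F V}
    (h : ∀ (l : ℤ) (v : V), v ∈ K.eigenspace (q ^ l) → f v = g v) : f = g := by
  ext v
  have hv : v ∈ (⨆ l : ℤ, K.eigenspace (q ^ l)) := by rw [ht]; trivial
  induction hv using Submodule.iSup_induction' with
  | mem l v hv => exact h l v hv
  | zero => simp
  | add a b _ _ ha hb => rw [map_add, map_add, ha, hb]

theorem pow_shift {F : Type*} [Field F] {q : F}
    {V : Type*} [AddCommGroup V] [Module F V] {K : Module.End F V}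
    {n : Module.End F V} {d : ℤ}
    (h : ∀ (l : ℤ) (v : V), v ∈ K.eigenspace (q ^ l) → n v ∈ K.eigenspace (q ^ (l + d)))
    (i : ℕ) (l : ℤ) (v : V) (hv : v ∈ K.eigenspace (q ^ l)) :
    (n ^ i) v ∈ K.eigenspace (q ^ (l + d * i)) := by
  induction i with
  | zero => simpa using hv
  | succ i ih =>
    rw [pow_succ', Module.End.mul_apply]
    have := h _ _ ih
    rwa [show l + d * i + d = l + d * ((i + 1 : ℕ) : ℤ) by push_cast; ring] at this

theorem shift_nilp {F : Type*} [Field F] {q : F} (hq : q ≠ 0)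
    (hroot : ∀ n : ℕ, 0 < n → q ^ n ≠ 1)
    {V : Type*} [AddCommGroup V] [Module F V] [FiniteDimensional F V] {K : Module.End F V}
    (ht : (⨆ l : ℤ, K.eigenspace (q ^ l)) = ⊤) {n : Module.End F V} {d : ℤ} (hd : d ≠ 0)
    (h : ∀ (l : ℤ) (v : V), v ∈ K.eigenspace (q ^ l) → n v ∈ K.eigenspace (q ^ (l + d))) :
    n ^ (Module.finrank F V) = 0 := by
  apply weight_ext ht
  intro l v hv
  rw [LinearMap.zero_apply, ← LinearMap.mem_ker]
  suffices ∃ m, (n ^ m) v = 0 by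
    obtain ⟨m, hm⟩ := this
    exact Module.End.ker_pow_le_ker_pow_finrank n m hm
  by_contra! hc
  have hinj : Function.Injective (fun i : ℕ => q ^ (l + d * i)) := by
    intro a b hab
    have := qpow_inj hq hroot hab
    have h2 : d * (a : ℤ) = d * b := by linarith
    exact_mod_cast mul_left_cancel₀ hd h2
  refine Set.infinite_range_of_injective hinj (K.finite_hasEigenvalue.subset ?_)
  rintro _ ⟨i, rfl⟩
  exact Module.End.hasEigenvalue_of_hasEigenvector ⟨pow_shift h i l v hv, hc i⟩

theorem choose_theta {F : Type*} [Field F] {θ : F} (h : θ ≠ 0) (i : ℕ) :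
    (θ ^ 2) ^ (i.choose 2) = θ ^ ((i : ℤ) ^ 2 - i) := by
  have : ((i.choose 2 : ℕ) : ℤ) * 2 = (i : ℤ) ^ 2 - i := by
    induction i with
    | zero => simp
    | succ k ih =>
      rw [Nat.choose_succ_succ' k 1]
      simp only [Nat.choose_one_right]
      push_cast
      linarith
  rw [← this, ← pow_mul, ← zpow_natCast]
  congr 1
  push_cast; ring

theorem neg_theta {F : Type*} [Field F] (θ : F) (m : ℤ) :
    (-θ) ^ m = (-1) ^ m * θ ^ m := by
  rw [← mul_zpow]; simp

theorem scal {F : Type*} [Field F] {q : F} (θ : F) (hq : q ≠ 0) (hθ : θ ^ 2 = q) (t l : ℤ)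
    (a b c : ℕ) (h : (a : ℤ) - b + c = l) (fa fb fc : F) :
    (q ^ (a.choose 2) / fa * ((-θ) ^ a * q ^ ((t + 1) * a * ((l - 2 * c + 2 * b) - a)))) *
    ((-θ) ^ (-((l - 2 * c + 2 * b) ^ 2)) *
    ((q ^ (b.choose 2) / fb * ((θ ^ b)⁻¹ * q ^ (-t * b * ((l - 2 * c) + b)))) *
    (q ^ (c.choose 2) / fc * ((-θ) ^ c * q ^ ((t + 1) * c * (l - c)))))) =
    (-1 : F) ^ b * q ^ ((a : ℤ) * (c : ℤ) - (b : ℤ)) / (fa * fb * fc) := by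
  have h0 : θ ≠ 0 := by rintro rfl; apply hq; rw [← hθ]; simp
  subst h
  have hz : ∀ m : ℤ, q ^ m = θ ^ (2 * m) := by
    intro m; rw [← hθ, ← zpow_natCast, ← zpow_mul]; norm_num
  have key : (q ^ (a.choose 2) * ((-θ) ^ a * q ^ ((t + 1) * a * ((((a : ℤ) - b + c) - 2 * c + 2 * b) - a)))) *
    ((-θ) ^ (-((((a : ℤ) - b + c) - 2 * c + 2 * b) ^ 2)) *
    ((q ^ (b.choose 2) * ((θ ^ b)⁻¹ * q ^ (-t * b * ((((a : ℤ) - b + c) - 2 * c) + b)))) *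
    (q ^ (c.choose 2) * ((-θ) ^ c * q ^ ((t + 1) * c * (((a : ℤ) - b + c) - c)))))) =
    (-1 : F) ^ b * q ^ ((a : ℤ) * (c : ℤ) - (b : ℤ)) := by
    simp only [hz]
    rw [← hθ]
    simp only [choose_theta h0]
    simp only [← zpow_natCast, neg_theta θ, ← zpow_neg]
    have hs : (-1 : F) ^ (a : ℤ) * (-1) ^ (-((((a : ℤ) - b + c) - 2 * c + 2 * b) ^ 2)) * (-1) ^ (c : ℤ)
        = (-1) ^ (b : ℤ) := by
      rw [← zpow_add₀ (by simp), ← zpow_add₀ (by simp), ← div_eq_one_iff_eq (zpow_ne_zero _ (by simp)),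
        ← zpow_sub₀ (by simp)]
      apply Even.neg_one_zpow
      simp only [Int.even_sub, Int.even_add, even_neg, Int.even_pow, Int.even_mul]
      grind
    rw [← hs]
    generalize (-1 : F) ^ (a : ℤ) = sa
    generalize (-1 : F) ^ (c : ℤ) = sc
    generalize (-1 : F) ^ (-((((a : ℤ) - b + c) - 2 * c + 2 * b) ^ 2)) = sm
    have e : ∀ p1 p2 p3 p4 p5 p6 p7 p8 p9 p10 p11 : ℤ,
        p1 + p2 + p3 + p4 + p5 + p6 + p7 + p8 + p9 + p10 = p11 →
        θ ^ p1 * (sa * θ ^ p2 * θ ^ p3) * (sm * θ ^ p4 * (θ ^ p5 * (θ ^ p6 * θ ^ p7) *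
          (θ ^ p8 * (sc * θ ^ p9 * θ ^ p10)))) = sa * sm * sc * θ ^ p11 := by
      intro p1 p2 p3 p4 p5 p6 p7 p8 p9 p10 p11 hp
      rw [← hp]
      simp only [zpow_add₀ h0]
      ring
    apply e
    ring
  rw [← key]
  ring

end helpers

/-- on a type-1 finite-dimensional U_q(sl2)-module V (given by endomorphisms
E, F and an invertible K satisfying the Chevalley relations, with K diagonalizable with all
eigenvalues integer powers of q), the inverse Lusztig operator T⁻¹ equals
exp_q(n_z) ∘ 𝔯, where 𝔯 = exp_q(n_x) ∘ Υ ∘ exp_q(n_z) is the rotator and Υ acts on the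
weight space V(λ) as the scalar (−θ)^{−λ²}  (θ² = q). -/
theorem stmt19 (hq : q ≠ 0) (hroot : ∀ n : ℕ, 0 < n → q ^ n ≠ 1)
    (θ : F) (hθ : θ ^ 2 = q) (t : ℤ)
    (V : Type*) [AddCommGroup V] [Module F V] [FiniteDimensional F V] [Nontrivial V]
    (E Fo : Module.End F V) (K : (Module.End F V)ˣ)
    (hke : (K : Module.End F V) * E = (q ^ 2) • (E * (K : Module.End F V)))
    (hkf : (K : Module.End F V) * Fo = (q⁻¹ ^ 2) • (Fo * (K : Module.End F V)))
    (hef : E * Fo - Fo * E =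
      (q - q⁻¹)⁻¹ • ((K : Module.End F V) - ((K⁻¹ : (Module.End F V)ˣ) : Module.End F V)))
    (htype1 : (⨆ l : ℤ, Module.End.eigenspace (K : Module.End F V) (q ^ l)) = ⊤)
    (x y z nx nz : Module.End F V)
    (hx : x = ((K ^ (-1 : ℤ) : (Module.End F V)ˣ) : Module.End F V) -
      (q ^ (1 + t) * (q - q⁻¹) * θ⁻¹) •
        (((K ^ (-1 - t) : (Module.End F V)ˣ) : Module.End F V) * E))
    (hy : y = (K : Module.End F V))
    (hz : z = ((K ^ (-1 : ℤ) : (Module.End F V)ˣ) : Module.End F V) +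
      (q ^ (-t) * (q - q⁻¹) * θ) • (Fo * ((K ^ t : (Module.End F V)ˣ) : Module.End F V)))
    (hnx : nx = (q / (q - q⁻¹)) • (1 - y * z))
    (hnz : nz = (q / (q - q⁻¹)) • (1 - x * y))
    (Υ Tinv : Module.End F V)
    (hΥ : ∀ (l : ℤ) (v : V), v ∈ Module.End.eigenspace (K : Module.End F V) (q ^ l) →
      Υ v = ((-θ) ^ (-(l ^ 2)) : F) • v)
    (hTinv : ∀ (l : ℤ) (v : V), v ∈ Module.End.eigenspace (K : Module.End F V) (q ^ l) →
      Tinv v =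
        ∑ a ∈ Finset.range (Module.finrank F V + 1),
          ∑ b ∈ Finset.range (Module.finrank F V + 1),
            ∑ c ∈ Finset.range (Module.finrank F V + 1),
              if (a : ℤ) - (b : ℤ) + (c : ℤ) = l then
                (((-1 : F) ^ b * q ^ ((a : ℤ) * (c : ℤ) - (b : ℤ)) /
                    (qFact F q a * qFact F q b * qFact F q c)) •
                  (Fo ^ a * E ^ b * Fo ^ c)) v
              else 0) :
    Tinv = expq F q nz * (expq F q nx * Υ * expq F q nz) := by
  have hθ0 : θ ≠ 0 := by rintro rfl; apply hq; rw [← hθ]; simp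
  have hs := s_ne hq hroot
  set k : Module.End F V := (K : Module.End F V) with hk
  set k' : Module.End F V := ((K⁻¹ : (Module.End F V)ˣ) : Module.End F V) with hk'
  have hkk' : k * k' = 1 := K.mul_inv
  have hk'k : k' * k = 1 := K.inv_mul
  have hW : ∀ (l : ℤ) (v : V), v ∈ k.eigenspace (q ^ l) ↔ k v = q ^ l • v := fun l v =>
    Module.End.mem_eigenspace_iff
  have hk'v : ∀ (l : ℤ) (v : V), v ∈ k.eigenspace (q ^ l) → k' v = q ^ (-l) • v := by
    intro l v hv
    have h1 := congrArg k' ((hW l v).1 hv)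
    rw [← Module.End.mul_apply, hk'k, map_smul, Module.End.one_apply] at h1
    conv_rhs => rw [h1]
    rw [smul_smul, ← zpow_add₀ hq, neg_add_cancel, zpow_zero, one_smul]
  have hKm : ∀ (m l : ℤ) (v : V), v ∈ k.eigenspace (q ^ l) →
      ((K ^ m : (Module.End F V)ˣ) : Module.End F V) v = q ^ (l * m) • v := by
    intro m l v hv
    induction m using Int.induction_on with
    | zero => simp
    | succ i ih =>
      rw [zpow_add_one, Units.val_mul, Module.End.mul_apply, ← hk, (hW l v).1 hv, map_smul, ih,
        smul_smul, ← zpow_add₀ hq]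
      congr 2; ring
    | pred i ih =>
      rw [zpow_sub_one, Units.val_mul, Module.End.mul_apply, ← hk', hk'v l v hv, map_smul, ih,
        smul_smul, ← zpow_add₀ hq]
      congr 2; ring
  have hEW : ∀ (l : ℤ) (v : V), v ∈ k.eigenspace (q ^ l) → E v ∈ k.eigenspace (q ^ (l + 2)) := by
    intro l v hv
    rw [hW, ← Module.End.mul_apply, hke, LinearMap.smul_apply, Module.End.mul_apply,
      (hW l v).1 hv, map_smul, smul_smul, zpow_add₀ hq, mul_comm]
    norm_cast
  have hFW : ∀ (l : ℤ) (v : V), v ∈ k.eigenspace (q ^ l) → Fo v ∈ k.eigenspace (q ^ (l + -2)) := by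
    intro l v hv
    rw [hW, ← Module.End.mul_apply, hkf, LinearMap.smul_apply, Module.End.mul_apply,
      (hW l v).1 hv, map_smul, smul_smul, zpow_add₀ hq, mul_comm, zpow_neg, inv_pow]
    norm_cast
  obtain ⟨α, hα⟩ : ∃ α : ℤ → F, ∀ l, α l = q ^ (1 + t) * (q - q⁻¹) * θ⁻¹ * q ^ ((l + 2) * (-1 - t)) :=
    ⟨_, fun _ => rfl⟩
  obtain ⟨β, hβ⟩ : ∃ β : ℤ → F, ∀ l, β l = q ^ (-t) * (q - q⁻¹) * θ * q ^ (l * t) :=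
    ⟨_, fun _ => rfl⟩
  have hαβ : ∀ l, α l * β (l + 2) = (q - q⁻¹) ^ 2 * q ^ (-l - 1) := by
    intro l
    rw [hα, hβ, show -l - 1 = (1 + t) + ((l + 2) * (-1 - t)) + -t + (l + 2) * t by ring]
    simp only [zpow_add₀ hq _ (-t), zpow_add₀ hq _ ((l + 2) * t), zpow_add₀ hq (1 + t)]
    field_simp
  have hxv : ∀ (l : ℤ) (v : V), v ∈ k.eigenspace (q ^ l) → x v = q ^ (-l) • v - α l • E v := by
    intro l v hv
    rw [hx, LinearMap.sub_apply, LinearMap.smul_apply, Module.End.mul_apply, hKm _ _ _ hv,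
      hKm _ _ _ (hEW l v hv), smul_smul, hα]
    congr 3; ring
  have hzv : ∀ (l : ℤ) (v : V), v ∈ k.eigenspace (q ^ l) → z v = q ^ (-l) • v + β l • Fo v := by
    intro l v hv
    rw [hz, LinearMap.add_apply, LinearMap.smul_apply, Module.End.mul_apply, hKm _ _ _ hv,
      hKm _ _ _ hv, map_smul, smul_smul, hβ]
    congr 3; ring
  have hyv : ∀ (l : ℤ) (v : V), v ∈ k.eigenspace (q ^ l) → y v = q ^ l • v := by
    intro l v hv
    rw [hy]; exact (hW l v).1 hv
  have hEF : ∀ (l : ℤ) (v : V), v ∈ k.eigenspace (q ^ l) →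
      E (Fo v) = Fo (E v) + ((q - q⁻¹)⁻¹ * (q ^ l - q ^ (-l))) • v := by
    intro l v hv
    have h1 := congrArg (fun w : Module.End F V => w v) hef
    simp only [LinearMap.sub_apply, Module.End.mul_apply, LinearMap.smul_apply,
      (hW l v).1 hv, hk'v l v hv] at h1
    rw [← sub_smul, smul_smul] at h1
    rw [← h1]; abel
  have hXY : q • (x * y) - q⁻¹ • (y * x) = (q - q⁻¹) • 1 := by
    apply weight_ext htype1
    intro l v hv
    simp only [LinearMap.sub_apply, Module.End.mul_apply, LinearMap.smul_apply,
      Module.End.one_apply, hyv l v hv, hxv l v hv, map_sub, map_smul, hyv _ _ (hEW l v hv)]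
    rw [zpow_neg, zpow_add₀ hq]
    match_scalars <;> field_simp
    ring
  have hYZ : q • (y * z) - q⁻¹ • (z * y) = (q - q⁻¹) • 1 := by
    apply weight_ext htype1
    intro l v hv
    simp only [LinearMap.sub_apply, Module.End.mul_apply, LinearMap.smul_apply,
      Module.End.one_apply, hyv l v hv, hzv l v hv, map_add, map_smul, hyv _ _ (hFW l v hv)]
    rw [zpow_neg, zpow_add₀ hq, zpow_neg]
    match_scalars <;> field_simp
    ring
  have hZX : q • (z * x) - q⁻¹ • (x * z) = (q - q⁻¹) • 1 := by
    apply weight_ext htype1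
    intro l v hv
    have h1 := hαβ l
    have h2 := hαβ (l + -2)
    rw [show l + -2 + 2 = l by ring] at h2
    simp only [LinearMap.sub_apply, Module.End.mul_apply, LinearMap.smul_apply,
      Module.End.one_apply, hxv l v hv, hzv l v hv, map_add, map_sub, map_smul,
      hzv _ _ (hEW l v hv), hxv _ _ (hFW l v hv), hEF l v hv]
    have g1 : q * (α l * β (l + 2)) = q⁻¹ * (α (l + -2) * β l) := by
      rw [h1, h2, show - (l + -2) - 1 = (-l - 1) + 2 by ring, zpow_add₀ hq _ 2]
      field_simp
    have g2 : q⁻¹ * (α (l + -2) * β l) = (q - q⁻¹) ^ 2 * q ^ (-l) := by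
      rw [h2, show - (l + -2) - 1 = -l + 1 by ring, zpow_add₀ hq _ 1, zpow_one]
      field_simp
    have e1 : q * q ^ (-(l + 2)) = q⁻¹ * q ^ (-l) := by
      rw [show -(l + 2) = -l - 2 by ring, zpow_sub₀ hq]; field_simp
    have e2 : q⁻¹ * q ^ (-(l + -2)) = q * q ^ (-l) := by
      rw [show -(l + -2) = -l + 2 by ring, zpow_add₀ hq]; field_simp
    have e3 : q ^ l * q ^ (-l) = 1 := by rw [← zpow_add₀ hq]; simp
    generalize q ^ (-(l + 2)) = r1 at *
    generalize q ^ (-(l + -2)) = r2 at *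
    generalize q ^ (-l) = r3 at *
    generalize q ^ l = r4 at *
    match_scalars
    · have : (q - q⁻¹)⁻¹ * (q - q⁻¹) = 1 := inv_mul_cancel₀ hs
      linear_combination ((q - q⁻¹)⁻¹ * (r4 - r3)) * g2 + (q - q⁻¹) * e3 + ((q-q⁻¹) * r3 * (r4 - r3)) * this
    · linear_combination (-β l) * e2
    · linear_combination (- α l) * e1
    · linear_combination -g1
  have hu2 : ∀ l : ℤ, (-θ) ^ (-((l + 2) ^ 2)) * q ^ (2 * l + 2) = (-θ) ^ (-(l ^ 2)) := by
    intro l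
    have : q = (-θ) ^ (2 : ℤ) := by rw [← hθ]; norm_cast; ring
    rw [this, ← zpow_mul, ← zpow_add₀ (neg_ne_zero.mpr hθ0)]
    congr 1; ring
  have hU1 : Υ * (y * x * y) = (x + y - k') * Υ := by
    apply weight_ext htype1
    intro l v hv
    simp only [LinearMap.sub_apply, LinearMap.add_apply, Module.End.mul_apply, hyv l v hv,
      hxv l v hv, map_sub, map_smul, hyv _ _ (hEW l v hv), hΥ l v hv, hΥ _ _ (hEW l v hv),
      hk'v l v hv]
    rw [← hu2 l]
    have e3 : q ^ l * q ^ (-l) = 1 := by rw [← zpow_add₀ hq]; simp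
    have e4 : q ^ (2 * l + 2) = q ^ l * q ^ (l + 2) := by rw [← zpow_add₀ hq]; congr 1; ring
    rw [e4]
    match_scalars
    · linear_combination ((-θ) ^ (-((l + 2) ^ 2)) * q ^ l * q ^ (l + 2) * q ^ l) * e3
    · ring
  have hU2 : Υ * (z + y - k') = y * z * y * Υ := by
    apply weight_ext htype1
    intro l v hv
    have h1 := hu2 (l + -2)
    rw [show l + -2 + 2 = l by ring] at h1
    simp only [LinearMap.sub_apply, LinearMap.add_apply, Module.End.mul_apply, hyv l v hv,
      hzv l v hv, map_sub, map_add, map_smul, hyv _ _ (hFW l v hv), hΥ l v hv, hΥ _ _ (hFW l v hv),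
      hk'v l v hv]
    rw [← h1]
    have e3 : q ^ l * q ^ (-l) = 1 := by rw [← zpow_add₀ hq]; simp
    have e4 : q ^ (2 * (l + -2) + 2) = q ^ l * q ^ (l + -2) := by
      rw [← zpow_add₀ hq]; congr 1; ring
    rw [e4]
    match_scalars
    · linear_combination (-(-θ) ^ (-(l ^ 2)) * q ^ l) * e3
    · ring
  have hnzv : ∀ (l : ℤ) (v : V), v ∈ k.eigenspace (q ^ l) →
      nz v = (θ⁻¹ * q ^ (-t * (l + 1))) • E v := by
    intro l v hv
    have e3 : q ^ l * q ^ (-l) = 1 := by rw [← zpow_add₀ hq]; simp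
    have e5 : q / (q - q⁻¹) * (q ^ l * α l) = θ⁻¹ * q ^ (-t * (l + 1)) := by
      rw [hα, show -t * (l + 1) = 1 + l + (1 + t) + (l + 2) * (-1 - t) by ring,
        zpow_add₀ hq _ ((l + 2) * (-1 - t)), zpow_add₀ hq _ (1 + t), zpow_add₀ hq 1 l, zpow_one,
        div_mul_eq_mul_div, div_eq_iff hs]
      ring
    rw [← e5, hnz]
    simp only [LinearMap.smul_apply, LinearMap.sub_apply, Module.End.one_apply,
      Module.End.mul_apply, hyv l v hv, hxv l v hv, map_smul]
    match_scalars
    · linear_combination -(q / (q - q⁻¹)) * e3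
    · ring
  have hnxv : ∀ (l : ℤ) (v : V), v ∈ k.eigenspace (q ^ l) →
      nx v = (-θ * q ^ ((t + 1) * (l - 1))) • Fo v := by
    intro l v hv
    have e3 : q ^ l * q ^ (-l) = 1 := by rw [← zpow_add₀ hq]; simp
    have e5 : -(q / (q - q⁻¹) * (q ^ (l + -2) * β l)) = -θ * q ^ ((t + 1) * (l - 1)) := by
      rw [hβ, show (t + 1) * (l - 1) = 1 + (l + -2) + (-t) + l * t by ring,
        zpow_add₀ hq _ (l * t), zpow_add₀ hq _ (-t), zpow_add₀ hq 1, zpow_one,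
        div_mul_eq_mul_div, neg_eq_iff_eq_neg, div_eq_iff hs]
      ring
    rw [← e5, hnx]
    simp only [LinearMap.smul_apply, LinearMap.sub_apply, Module.End.one_apply,
      Module.End.mul_apply, hyv _ _ (hFW l v hv), hyv l v hv, hzv l v hv, map_smul, map_add]
    match_scalars
    · linear_combination -(q / (q - q⁻¹)) * e3
    · ring
  have hnzW : ∀ (l : ℤ) (v : V), v ∈ k.eigenspace (q ^ l) → nz v ∈ k.eigenspace (q ^ (l + 2)) := by
    intro l v hv
    rw [hnzv l v hv]; exact Submodule.smul_mem _ _ (hEW l v hv)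
  have hnxW : ∀ (l : ℤ) (v : V), v ∈ k.eigenspace (q ^ l) → nx v ∈ k.eigenspace (q ^ (l + -2)) := by
    intro l v hv
    rw [hnxv l v hv]; exact Submodule.smul_mem _ _ (hFW l v hv)
  have hnilz := shift_nilp hq hroot htype1 (by norm_num) hnzW
  have hnilx := shift_nilp hq hroot htype1 (by norm_num) hnxW
  obtain ⟨hb, hw⟩ := braid hq hroot x y k' z nx nz Υ (by rw [hy]; exact hkk') (by rw [hy]; exact hk'k)
    hXY hYZ hZX hnx hnz hnilx hnilz hU1 hU2
  have hnzp : ∀ (b : ℕ) (l : ℤ) (v : V), v ∈ k.eigenspace (q ^ l) →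
      (nz ^ b) v = ((θ ^ b)⁻¹ * q ^ (-t * b * (l + b))) • (E ^ b) v := by
    intro b l v hv
    induction b with
    | zero => simp
    | succ b ih =>
      rw [pow_succ', Module.End.mul_apply, ih, map_smul, hnzv _ _ (pow_shift hEW b l v hv),
        smul_smul, pow_succ' E, Module.End.mul_apply]
      congr 1
      rw [show -t * ((b + 1 : ℕ) : ℤ) * (l + ((b + 1 : ℕ) : ℤ)) =
        -t * b * (l + b) + -t * (l + 2 * b + 1) by push_cast; ring, zpow_add₀ hq, pow_succ, mul_inv]
      ring
  have hnxp : ∀ (b : ℕ) (l : ℤ) (v : V), v ∈ k.eigenspace (q ^ l) →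
      (nx ^ b) v = ((-θ) ^ b * q ^ ((t + 1) * b * (l - b))) • (Fo ^ b) v := by
    intro b l v hv
    induction b with
    | zero => simp
    | succ b ih =>
      rw [pow_succ', Module.End.mul_apply, ih, map_smul, hnxv _ _ (pow_shift hFW b l v hv),
        smul_smul, pow_succ' Fo, Module.End.mul_apply]
      congr 1
      rw [show (t + 1) * ((b + 1 : ℕ) : ℤ) * (l - ((b + 1 : ℕ) : ℤ)) =
        (t + 1) * b * (l - b) + (t + 1) * (l + -2 * b - 1) by push_cast; ring, zpow_add₀ hq, pow_succ]
      ring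
  apply weight_ext htype1
  intro l v hv
  rw [hTinv l v hv]
  have hRW : (expq F q nz * (expq F q nx * Υ * expq F q nz)) v ∈ k.eigenspace (q ^ (-l)) := by
    have h1 := congrArg (fun w : Module.End F V => w v) hw
    simp only [Module.End.mul_apply] at h1
    rw [hyv l v hv] at h1
    simp only [map_smul] at h1
    rw [hW]
    simp only [Module.End.mul_apply]
    rw [hy] at h1
    nth_rewrite 2 [← h1]
    rw [smul_smul, ← zpow_add₀ hq, neg_add_cancel, zpow_zero, one_smul]
  rw [hb] at hRW ⊢
  set N := Module.finrank F V + 1 with hN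
  set S := Finset.range N ×ˢ Finset.range N ×ˢ Finset.range N with hS
  obtain ⟨w, hwdef⟩ : ∃ w : ℕ × ℕ × ℕ → V, ∀ p, w p =
      (q ^ (p.1.choose 2) / qFact F q p.1 * ((-θ) ^ p.1 * q ^ ((t + 1) * p.1 * ((l - 2 * p.2.2 + 2 * p.2.1) - p.1))) *
      ((-θ) ^ (-((l - 2 * (p.2.2 : ℤ) + 2 * p.2.1) ^ 2)) *
      ((q ^ (p.2.1.choose 2) / qFact F q p.2.1 * ((θ ^ p.2.1)⁻¹ * q ^ (-t * p.2.1 * ((l - 2 * p.2.2) + p.2.1)))) *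
      (q ^ (p.2.2.choose 2) / qFact F q p.2.2 * ((-θ) ^ p.2.2 * q ^ ((t + 1) * p.2.2 * (l - p.2.2))))))) •
      (Fo ^ p.1 * E ^ p.2.1 * Fo ^ p.2.2) v := ⟨_, fun _ => rfl⟩
  have hWF : ∀ c : ℕ, (Fo ^ c) v ∈ k.eigenspace (q ^ (l - 2 * (c : ℤ))) := by
    intro c
    have := pow_shift hFW c l v hv
    rwa [show l + -2 * (c : ℤ) = l - 2 * c by ring] at this
  have hWE : ∀ b c : ℕ, (E ^ b) ((Fo ^ c) v) ∈ k.eigenspace (q ^ (l - 2 * (c : ℤ) + 2 * b)) :=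
    fun b c => pow_shift hEW b _ _ (hWF c)
  have hsum : (expq F q nx * Υ * expq F q nz * expq F q nx) v = ∑ p ∈ S, w p := by
    rw [hS, Finset.sum_product]
    simp only [Finset.sum_product]
    simp only [Module.End.mul_apply]
    have h1 : expq F q nx v = ∑ c ∈ Finset.range N,
        (q ^ (c.choose 2) / qFact F q c * ((-θ) ^ c * q ^ ((t + 1) * c * (l - c)))) • (Fo ^ c) v := by
      unfold expq
      rw [LinearMap.sum_apply]
      refine Finset.sum_congr rfl fun c _ => ?_
      rw [LinearMap.smul_apply, hnxp c l v hv, smul_smul]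
    have h2 : ∀ c : ℕ, expq F q nz ((Fo ^ c) v) = ∑ b ∈ Finset.range N,
        (q ^ (b.choose 2) / qFact F q b * ((θ ^ b)⁻¹ * q ^ (-t * b * ((l - 2 * c) + b)))) •
          (E ^ b) ((Fo ^ c) v) := by
      intro c
      unfold expq
      rw [LinearMap.sum_apply]
      refine Finset.sum_congr rfl fun b _ => ?_
      rw [LinearMap.smul_apply, hnzp b _ _ (hWF c), smul_smul]
    have h3 : ∀ b c : ℕ, expq F q nx ((E ^ b) ((Fo ^ c) v)) = ∑ a ∈ Finset.range N,
        (q ^ (a.choose 2) / qFact F q a * ((-θ) ^ a * q ^ ((t + 1) * a * ((l - 2 * c + 2 * b) - a)))) •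
          (Fo ^ a) ((E ^ b) ((Fo ^ c) v)) := by
      intro b c
      unfold expq
      rw [LinearMap.sum_apply]
      refine Finset.sum_congr rfl fun a _ => ?_
      rw [LinearMap.smul_apply, hnxp a _ _ (hWE b c), smul_smul]
    have hΥ' : ∀ b c : ℕ, Υ ((E ^ b) ((Fo ^ c) v)) =
        (-θ) ^ (-((l - 2 * (c : ℤ) + 2 * b) ^ 2)) • (E ^ b) ((Fo ^ c) v) :=
      fun b c => hΥ _ _ (hWE b c)
    rw [h1]
    simp only [map_sum, map_smul, h2, hΥ', h3, Finset.smul_sum, smul_smul]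
    rw [Finset.sum_comm' (t' := Finset.range N) (s' := fun _ => Finset.range N) (by simp [and_comm])]
    rw [Finset.sum_congr rfl fun b _ => Finset.sum_comm]
    rw [Finset.sum_comm]
    refine Finset.sum_congr rfl fun a _ => Finset.sum_congr rfl fun b _ =>
      Finset.sum_congr rfl fun c _ => ?_
    rw [hwdef]
    simp only [Module.End.mul_apply]
    congr 1
    ring
  rw [hsum] at hRW ⊢
  have hcomp := weight_component hq hroot k S w
    (fun p => l - 2 * (p.2.2 : ℤ) + 2 * p.2.1 - 2 * p.1) (by
      intro p _
      rw [hwdef]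
      apply Submodule.smul_mem
      have := pow_shift hFW p.1 _ _ (hWE p.2.1 p.2.2)
      rw [show l - 2 * (p.2.2 : ℤ) + 2 * p.2.1 + -2 * p.1 =
        l - 2 * (p.2.2 : ℤ) + 2 * p.2.1 - 2 * p.1 by ring] at this
      exact this) (-l) hRW
  rw [hcomp, hS, Finset.sum_product]
  simp only [Finset.sum_product]
  refine Finset.sum_congr rfl fun a _ => Finset.sum_congr rfl fun b _ =>
      Finset.sum_congr rfl fun c _ => ?_
  by_cases h : (a : ℤ) - b + c = l
  · rw [if_pos h, if_pos (by omega), hwdef, LinearMap.smul_apply]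
    congr 1
    exact (scal θ hq hθ t l a b c h _ _ _).symm
  · rw [if_neg h, if_neg (by omega)]

end Lusztig
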